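/- There is a unique group homomorphism ι : M04 → PSL(2,ℤ) with ι(σ1) = ι(σ3) = [A] and ι(σ2) = [B], where A = !![1,1; 0,1] and B = !![1,0; -1,1]; this homomorphism is surjective, and its kernel equals the subgroup N. In particular there is a short exact sequence 1 → N → M04 → PSL(2,ℤ) → 1. -/

import Mathlib

/-- `SL(2,ℤ)`: 2×2 integer matrices of determinant 1. -/
abbrev SL2Z := Matrix.SpecialLinearGroup (Fin 2) ℤ

/-- The matrix `A = !![1,1; 0,1]` as an element of `SL(2,ℤ)`. -/
def MA : SL2Z := ⟨!![1, 1; 0, 1], by norm_num [Matrix.det_fin_two_of]⟩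

/-- The matrix `B = !![1,0; -1,1]` as an element of `SL(2,ℤ)`. -/
def MB : SL2Z := ⟨!![1, 0; -1, 1], by norm_num [Matrix.det_fin_two_of]⟩

/-- `PSL(2,ℤ)`: the quotient of `SL(2,ℤ)` by its center `{±1}`. -/
abbrev PSL2Z := SL2Z ⧸ Subgroup.center SL2Z

/-- Relations for the presented group
`M04 = ⟨σ1, σ2, σ3 | σ1σ3 = σ3σ1, σ1σ2σ1 = σ2σ1σ2, σ3σ2σ3 = σ2σ3σ2,
(σ1σ2σ3)⁴ = 1, σ1σ2σ3²σ2σ1 = 1⟩`, a presentation of the mapping class group of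
the 4-punctured sphere, with `σ1, σ2, σ3` corresponding to `0, 1, 2`. -/
def m4Rels : Set (FreeGroup (Fin 3)) :=
  { FreeGroup.of 0 * FreeGroup.of 2 * (FreeGroup.of 2 * FreeGroup.of 0)⁻¹,
    FreeGroup.of 0 * FreeGroup.of 1 * FreeGroup.of 0 *
      (FreeGroup.of 1 * FreeGroup.of 0 * FreeGroup.of 1)⁻¹,
    FreeGroup.of 2 * FreeGroup.of 1 * FreeGroup.of 2 *
      (FreeGroup.of 1 * FreeGroup.of 2 * FreeGroup.of 1)⁻¹,
    (FreeGroup.of 0 * FreeGroup.of 1 * FreeGroup.of 2) ^ 4,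
    FreeGroup.of 0 * FreeGroup.of 1 * FreeGroup.of 2 ^ 2 * FreeGroup.of 1 * FreeGroup.of 0 }

/-- The mapping class group of the 4-punctured sphere, by its presentation. -/
abbrev M04 := PresentedGroup m4Rels

/-- The generator `σ1` of `M04`. -/
def m4s1 : M04 := PresentedGroup.of 0

/-- The generator `σ2` of `M04`. -/
def m4s2 : M04 := PresentedGroup.of 1

/-- The generator `σ3` of `M04`. -/
def m4s3 : M04 := PresentedGroup.of 2

/-- The element `a = σ1σ3⁻¹` of `M04`. -/
def ea : M04 := m4s1 * m4s3⁻¹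

/-- The element `b = σ2σ1σ3⁻¹σ2⁻¹` of `M04`. -/
def eb : M04 := m4s2 * m4s1 * m4s3⁻¹ * m4s2⁻¹

/-- The subgroup `N` of `M04` generated by `a` and `b`. -/
def Nsub : Subgroup M04 := Subgroup.closure {ea, eb}

/-- The subgroup `G` of `M04` generated by `σ1` and `σ2`. -/
def Gsub : Subgroup M04 := Subgroup.closure {m4s1, m4s2}

theorem coeA : (MA : Matrix (Fin 2) (Fin 2) ℤ) = !![1, 1; 0, 1] := rfl
theorem coeB : (MB : Matrix (Fin 2) (Fin 2) ℤ) = !![1, 0; -1, 1] := rfl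

inductive PosWord {Q : Type*} [Group Q] (x y : Q) : Q → Prop
  | one : PosWord x y 1
  | cx (w : Q) : PosWord x y w → PosWord x y (x * w)
  | cy (w : Q) : PosWord x y w → PosWord x y (y⁻¹ * w)

theorem psl_mk_eq {M M' : SL2Z} (h : (QuotientGroup.mk M : PSL2Z) = QuotientGroup.mk M') :
    (∀ i j, M' i j = M i j) ∨ (∀ i j, M' i j = - M i j) := by
  rw [QuotientGroup.eq, Matrix.SpecialLinearGroup.mem_center_iff] at h
  obtain ⟨r, hr, h⟩ := h
  have hM : M' = M * (M⁻¹ * M') := by group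
  have e : ∀ i j, M' i j = r * M i j := by
    intro i j
    have : (M' : Matrix (Fin 2) (Fin 2) ℤ) = M * Matrix.scalar (Fin 2) r := by
      rw [h, ← Matrix.SpecialLinearGroup.coe_mul, ← hM]
    rw [this, Matrix.scalar_apply, Matrix.mul_diagonal, mul_comm]
  have hr : r ^ 2 = 1 := by simpa using hr
  rcases eq_or_eq_neg_of_sq_eq_sq r 1 (by rw [hr]; norm_num) with h | h
  · left; intro i j; rw [e, h]; ring
  · right; intro i j; rw [e, h]; ring

theorem posWord_mat {Q : Type*} [Group Q] {x y : Q} (f : Q →* PSL2Z)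
    (hx : f x = QuotientGroup.mk MA) (hy : f y = QuotientGroup.mk MB) {w : Q}
    (hw : PosWord x y w) : ∃ M : SL2Z, f w = QuotientGroup.mk M ∧ 1 ≤ M 0 0 ∧ 0 ≤ M 0 1 ∧
      0 ≤ M 1 0 ∧ 1 ≤ M 1 1 ∧ (w = 1 ∨ 1 ≤ M 0 1 + M 1 0) := by
  induction hw with
  | one => exact ⟨1, by simp, by simp, by simp, by simp, by simp, Or.inl rfl⟩
  | cx w _ ih =>
    obtain ⟨M, h, h1, h2, h3, h4, h5⟩ := ih
    refine ⟨MA * M, by rw [map_mul, hx, h]; rfl, ?_⟩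
    simp only [coeA, Matrix.SpecialLinearGroup.coe_mul, Matrix.mul_apply, Fin.sum_univ_two]
    simp
    refine ⟨by omega, by omega, by omega, by omega, Or.inr (by omega)⟩
  | cy w _ ih =>
    obtain ⟨M, h, h1, h2, h3, h4, h5⟩ := ih
    refine ⟨MB⁻¹ * M, by rw [map_mul, map_inv, hy, h]; rfl, ?_⟩
    simp only [coeB, Matrix.SpecialLinearGroup.coe_mul, Matrix.mul_apply, Fin.sum_univ_two,
      Matrix.SpecialLinearGroup.coe_inv, Matrix.adjugate_fin_two]
    simp
    refine ⟨by omega, by omega, by omega, by omega, Or.inr (by omega)⟩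

theorem normal_form {Q : Type*} [Group Q] {x y : Q} (hb : x * y * x = y * x * y)
    (hs : (x * y * x) * (x * y * x) = 1) (hgen : Subgroup.closure {x, y} = ⊤) (g : Q) :
    ∃ p w q, g = p * w * q ∧ (p = 1 ∨ p = x * y * x) ∧ PosWord x y w ∧
      (q = 1 ∨ q = x * y ∨ q = (x * y) * (x * y)) := by
  obtain ⟨s, hs'⟩ : ∃ s, s = x * y * x := ⟨_, rfl⟩
  obtain ⟨u, hu'⟩ : ∃ u, u = x * y := ⟨_, rfl⟩
  rw [← hs'] at hs ⊢
  rw [← hu']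
  have hxs : s = u * x := by rw [hs', hu']
  have hu3 : u * u * u = 1 := by
    rw [← hs]
    nth_rw 2 [hs']
    rw [hb, hs', hu']; group
  have hsu : u * s = y⁻¹ := by
    have : u * s * y = 1 := by rw [← hu3, hs', hu']; group
    exact eq_inv_of_mul_eq_one_left this
  have huy : u * y⁻¹ = x := by rw [hu']; group
  let P : Q → Prop := fun g => ∃ p w q, g = p * w * q ∧ (p = 1 ∨ p = s) ∧ PosWord x y w ∧
      (q = 1 ∨ q = u ∨ q = u * u)
  have Ps : ∀ g, P g → P (s * g) := by
    rintro g ⟨p, w, q, rfl, hp, hw, hq⟩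
    rcases hp with rfl | rfl
    · exact ⟨s, w, q, by group, Or.inr rfl, hw, hq⟩
    · exact ⟨1, w, q, by rw [← mul_assoc, ← mul_assoc, hs], Or.inl rfl, hw, hq⟩
  have Pu : ∀ g, P g → P (u * g) := by
    rintro g ⟨p, w, q, rfl, hp, hw, hq⟩
    rcases hp with rfl | rfl
    · cases hw with
      | one =>
        rcases hq with rfl | rfl | rfl
        · exact ⟨1, 1, u, by group, Or.inl rfl, .one, by simp⟩
        · exact ⟨1, 1, q * q, by group, Or.inl rfl, .one, by simp⟩
        · exact ⟨1, 1, 1, by simpa [mul_assoc] using hu3, Or.inl rfl, .one, by simp⟩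
      | cx w hw => exact ⟨s, w, q, by rw [hxs]; group, Or.inr rfl, hw, hq⟩
      | cy w hw => exact ⟨1, x * w, q, by rw [← huy]; group, Or.inl rfl, .cx _ hw, hq⟩
    · exact ⟨1, y⁻¹ * w, q, by rw [← hsu]; group, Or.inl rfl, .cy _ hw, hq⟩
  have hui : u⁻¹ = u * u := inv_eq_of_mul_eq_one_left hu3
  have hsi : s⁻¹ = s := inv_eq_of_mul_eq_one_left hs
  have hx : x = u * u * s := by rw [← hui, hxs]; group
  have hxi : x⁻¹ = s * u := by rw [hx, mul_inv_rev, hsi, ← hui, inv_inv]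
  have hyi : y⁻¹ = u * s := hsu.symm
  have hy : y = s * u * u := by rw [← inv_inv y, hyi, mul_inv_rev, hsi, hui, mul_assoc]
  have key : ∀ g ∈ Subgroup.closure {x, y}, P g := by
    intro g hg
    induction hg using Subgroup.closure_induction_left with
    | one => exact ⟨1, 1, 1, by group, Or.inl rfl, .one, by simp⟩
    | mul_left z hz g _ ih =>
      rcases hz with rfl | hz
      · rw [hx, mul_assoc, mul_assoc]; exact Pu _ (Pu _ (Ps _ ih))
      · rw [Set.mem_singleton_iff] at hz
        rw [hz, hy, mul_assoc, mul_assoc]; exact Ps _ (Pu _ (Pu _ ih))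
    | inv_mul_cancel z hz g _ ih =>
      rcases hz with rfl | hz
      · rw [hxi, mul_assoc]; exact Ps _ (Pu _ ih)
      · rw [Set.mem_singleton_iff] at hz
        rw [hz, hyi, mul_assoc]; exact Pu _ (Ps _ ih)
  exact key g (by rw [hgen]; trivial)

theorem psl_inj {Q : Type*} [Group Q] {x y : Q} (hb : x * y * x = y * x * y)
    (hs : (x * y * x) * (x * y * x) = 1) (hgen : Subgroup.closure {x, y} = ⊤)
    (f : Q →* PSL2Z)
    (hx : f x = QuotientGroup.mk MA) (hy : f y = QuotientGroup.mk MB) (g : Q) (hg : f g = 1) :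
    g = 1 := by
  obtain ⟨p, w, q, rfl, hp, hw, hq⟩ := normal_form hb hs hgen g
  obtain ⟨M, h, h1, h2, h3, h4, h5⟩ := posWord_mat f hx hy hw
  have e : f w = f (p⁻¹ * q⁻¹) := by
    have : w = p⁻¹ * (p * w * q) * q⁻¹ := by group
    rw [this, map_mul, map_mul, hg, mul_one, ← map_mul]
  have val : ∀ R : SL2Z, f (p⁻¹ * q⁻¹) = QuotientGroup.mk R →
      (∀ i j, M i j = R i j) ∨ (∀ i j, M i j = - R i j) := by
    intro R hR
    exact psl_mk_eq (hR.symm.trans (e.symm.trans h))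
  rcases hp with rfl | rfl <;> rcases hq with rfl | rfl | rfl
  · rcases val 1 (by simp) with k | k
    · have k1 := k 0 1
      have k2 := k 1 0
      simp at k1 k2
      rcases h5 with h5 | h5
      · simpa using h5
      · omega
    · have := k 0 0
      simp at this
      omega
  all_goals exfalso
  · have := val (1⁻¹ * (MA * MB)⁻¹) (by simp only [map_mul, map_inv, hx, hy, map_one]; rfl)
    simp [coeA, coeB, Matrix.SpecialLinearGroup.coe_mul, Matrix.mul_apply, Fin.sum_univ_two,
      Matrix.SpecialLinearGroup.coe_inv, Matrix.adjugate_fin_two, Fin.forall_fin_two] at this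
    omega
  · have := val (1⁻¹ * ((MA * MB) * (MA * MB))⁻¹)
      (by simp only [map_mul, map_inv, hx, hy, map_one]; rfl)
    simp [coeA, coeB, Matrix.SpecialLinearGroup.coe_mul, Matrix.mul_apply, Fin.sum_univ_two,
      Matrix.SpecialLinearGroup.coe_inv, Matrix.adjugate_fin_two, Fin.forall_fin_two] at this
    omega
  · have := val ((MA * MB * MA)⁻¹ * 1⁻¹) (by simp only [map_mul, map_inv, hx, hy, map_one]; rfl)
    simp [coeA, coeB, Matrix.SpecialLinearGroup.coe_mul, Matrix.mul_apply, Fin.sum_univ_two,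
      Matrix.SpecialLinearGroup.coe_inv, Matrix.adjugate_fin_two, Fin.forall_fin_two] at this
    omega
  · have := val ((MA * MB * MA)⁻¹ * (MA * MB)⁻¹)
      (by simp only [map_mul, map_inv, hx, hy]; rfl)
    simp [coeA, coeB, Matrix.SpecialLinearGroup.coe_mul, Matrix.mul_apply, Fin.sum_univ_two,
      Matrix.SpecialLinearGroup.coe_inv, Matrix.adjugate_fin_two, Fin.forall_fin_two] at this
    omega
  · have := val ((MA * MB * MA)⁻¹ * ((MA * MB) * (MA * MB))⁻¹)
      (by simp only [map_mul, map_inv, hx, hy]; rfl)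
    simp [coeA, coeB, Matrix.SpecialLinearGroup.coe_mul, Matrix.mul_apply, Fin.sum_univ_two,
      Matrix.SpecialLinearGroup.coe_inv, Matrix.adjugate_fin_two, Fin.forall_fin_two] at this
    omega

theorem r13 : m4s1 * m4s3 = m4s3 * m4s1 :=
  mul_inv_eq_one.mp (PresentedGroup.one_of_mem (rels := m4Rels)
    (x := FreeGroup.of 0 * FreeGroup.of 2 * (FreeGroup.of 2 * FreeGroup.of 0)⁻¹)
    (by simp [m4Rels]))

theorem r12 : m4s1 * m4s2 * m4s1 = m4s2 * m4s1 * m4s2 :=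
  mul_inv_eq_one.mp (PresentedGroup.one_of_mem (rels := m4Rels)
    (x := FreeGroup.of 0 * FreeGroup.of 1 * FreeGroup.of 0 *
      (FreeGroup.of 1 * FreeGroup.of 0 * FreeGroup.of 1)⁻¹) (by simp [m4Rels]))

theorem r32 : m4s3 * m4s2 * m4s3 = m4s2 * m4s3 * m4s2 :=
  mul_inv_eq_one.mp (PresentedGroup.one_of_mem (rels := m4Rels)
    (x := FreeGroup.of 2 * FreeGroup.of 1 * FreeGroup.of 2 *
      (FreeGroup.of 1 * FreeGroup.of 2 * FreeGroup.of 1)⁻¹) (by simp [m4Rels]))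

theorem r5 : m4s1 * m4s2 * m4s3 ^ 2 * m4s2 * m4s1 = 1 :=
  PresentedGroup.one_of_mem (rels := m4Rels)
    (x := FreeGroup.of 0 * FreeGroup.of 1 * FreeGroup.of 2 ^ 2 * FreeGroup.of 1 * FreeGroup.of 0)
    (by simp [m4Rels])

theorem gen3 : Subgroup.closure {m4s1, m4s2, m4s3} = (⊤ : Subgroup M04) := by
  rw [eq_top_iff, ← PresentedGroup.closure_range_of m4Rels, Subgroup.closure_le]
  rintro _ ⟨i, rfl⟩
  apply Subgroup.subset_closure
  fin_cases i
  · exact Or.inl rfl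
  · exact Or.inr (Or.inl rfl)
  · exact Or.inr (Or.inr rfl)

theorem ea_mem : ea ∈ Nsub := Subgroup.subset_closure (by simp)
theorem eb_mem : eb ∈ Nsub := Subgroup.subset_closure (by simp)

theorem c1a : m4s1 * ea * m4s1⁻¹ = ea := by
  rw [ea, mul_inv_eq_iff_eq_mul, mul_assoc m4s1 _ m4s1]
  congr 1
  rw [eq_inv_mul_iff_mul_eq, ← mul_assoc, ← r13]; group

theorem c1b : m4s1 * eb * m4s1⁻¹ = eb * ea⁻¹ := by
  have e2 : m4s2 * m4s3⁻¹ * m4s2⁻¹ = m4s3⁻¹ * m4s2⁻¹ * m4s3 := by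
    have := r32
    rw [mul_inv_eq_iff_eq_mul, mul_assoc, mul_assoc, eq_inv_mul_iff_mul_eq, eq_inv_mul_iff_mul_eq,
      ← mul_assoc, ← mul_assoc, ← this]; group
  calc m4s1 * eb * m4s1⁻¹ = (m4s1 * m4s2 * m4s1) * m4s3⁻¹ * m4s2⁻¹ * m4s1⁻¹ := by
        rw [eb]; group
    _ = m4s2 * m4s1 * (m4s2 * m4s3⁻¹ * m4s2⁻¹) * m4s1⁻¹ := by rw [r12]; group
    _ = eb * ea⁻¹ := by rw [e2, eb, ea]; group

theorem c2a : m4s2 * ea * m4s2⁻¹ = eb := by rw [ea, eb]; group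

theorem c2b : m4s2 * eb * m4s2⁻¹ = eb * ea⁻¹ * eb := by
  calc m4s2 * eb * m4s2⁻¹ = (m4s2 * (eb * ea⁻¹) * m4s2⁻¹) * (m4s2 * ea * m4s2⁻¹) := by group
    _ = (m4s2 * m4s1 * m4s2) * ea * (m4s2 * m4s1 * m4s2)⁻¹ * eb := by
        rw [← c1b, c2a, ← c2a]; group
    _ = m4s1 * (m4s2 * (m4s1 * ea * m4s1⁻¹) * m4s2⁻¹) * m4s1⁻¹ * eb := by
        rw [← r12]; group
    _ = _ := by rw [c1a, c2a, c1b]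

theorem c1a' : m4s1⁻¹ * ea * m4s1 = ea := by
  nth_rw 1 [← c1a]; group

theorem c1b' : m4s1⁻¹ * eb * m4s1 = eb * ea := by
  have : eb = (m4s1 * eb * m4s1⁻¹) * (m4s1 * ea * m4s1⁻¹) := by rw [c1a, c1b]; group
  nth_rw 1 [this]; group

theorem c2b' : m4s2⁻¹ * eb * m4s2 = ea := by rw [← c2a]; group

theorem c2a' : m4s2⁻¹ * ea * m4s2 = ea * eb⁻¹ * ea := by
  have h : ea = eb * (m4s2 * eb * m4s2⁻¹)⁻¹ * eb := by rw [c2b]; group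
  calc m4s2⁻¹ * ea * m4s2 = (m4s2⁻¹ * eb * m4s2) * eb⁻¹ * (m4s2⁻¹ * eb * m4s2) := by
        nth_rw 1 [h]; group
    _ = _ := by rw [c2b']

theorem conj_N {t : M04} (ha : t * ea * t⁻¹ ∈ Nsub) (hb : t * eb * t⁻¹ ∈ Nsub) :
    ∀ n ∈ Nsub, t * n * t⁻¹ ∈ Nsub := by
  have : Nsub ≤ Nsub.comap (MulAut.conj t).toMonoidHom := by
    conv_lhs => rw [Nsub]
    rw [Subgroup.closure_le]
    rintro z (rfl | hz)
    · simpa using ha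
    · rw [Set.mem_singleton_iff] at hz
      subst hz
      simpa using hb
  intro n hn
  simpa using this hn

theorem s3_eq : m4s3 = ea⁻¹ * m4s1 := by rw [ea]; group

theorem N_normal : Nsub.Normal := by
  have mA := ea_mem
  have mB := eb_mem
  have k1 : ∀ n ∈ Nsub, m4s1 * n * m4s1⁻¹ ∈ Nsub :=
    conj_N (by rw [c1a]; exact mA) (by rw [c1b]; exact mul_mem mB (inv_mem mA))
  have k1' : ∀ n ∈ Nsub, m4s1⁻¹ * n * m4s1⁻¹⁻¹ ∈ Nsub :=
    conj_N (by rw [inv_inv, c1a']; exact mA) (by rw [inv_inv, c1b']; exact mul_mem mB mA)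
  have k2 : ∀ n ∈ Nsub, m4s2 * n * m4s2⁻¹ ∈ Nsub :=
    conj_N (by rw [c2a]; exact mB)
      (by rw [c2b]; exact mul_mem (mul_mem mB (inv_mem mA)) mB)
  have k2' : ∀ n ∈ Nsub, m4s2⁻¹ * n * m4s2⁻¹⁻¹ ∈ Nsub :=
    conj_N (by rw [inv_inv, c2a']; exact mul_mem (mul_mem mA (inv_mem mB)) mA)
      (by rw [inv_inv, c2b']; exact mA)
  have k3 : ∀ n ∈ Nsub, m4s3 * n * m4s3⁻¹ ∈ Nsub := by
    intro n hn
    have : m4s3 * n * m4s3⁻¹ = ea⁻¹ * (m4s1 * n * m4s1⁻¹) * ea := by rw [s3_eq]; group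
    rw [this]
    exact mul_mem (mul_mem (inv_mem mA) (k1 n hn)) mA
  have k3' : ∀ n ∈ Nsub, m4s3⁻¹ * n * m4s3⁻¹⁻¹ ∈ Nsub := by
    intro n hn
    have : m4s3⁻¹ * n * m4s3⁻¹⁻¹ = m4s1⁻¹ * (ea * n * ea⁻¹) * m4s1⁻¹⁻¹ := by rw [s3_eq]; group
    rw [this]
    exact k1' _ (mul_mem (mul_mem mA hn) (inv_mem mA))
  constructor
  intro n hn g
  have hg : g ∈ Subgroup.closure {m4s1, m4s2, m4s3} := by rw [gen3]; trivial
  induction hg using Subgroup.closure_induction_left with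
  | one => simpa using hn
  | mul_left z hz g _ ih =>
    have : z * g * n * (z * g)⁻¹ = z * (g * n * g⁻¹) * z⁻¹ := by group
    rw [this]
    rcases hz with rfl | rfl | rfl
    exacts [k1 _ ih, k2 _ ih, k3 _ ih]
  | inv_mul_cancel z hz g _ ih =>
    have : z⁻¹ * g * n * (z⁻¹ * g)⁻¹ = z⁻¹ * (g * n * g⁻¹) * z⁻¹⁻¹ := by group
    rw [this]
    rcases hz with rfl | rfl | rfl
    exacts [k1' _ ih, k2' _ ih, k3' _ ih]

theorem center_neg : (MA * MB * MA) * (MA * MB * MA) ∈ Subgroup.center SL2Z := by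
  rw [Matrix.SpecialLinearGroup.mem_center_iff]
  refine ⟨-1, by simp, ?_⟩
  ext i j
  fin_cases i <;> fin_cases j <;>
    simp [coeA, coeB, Matrix.SpecialLinearGroup.coe_mul, Matrix.mul_apply, Fin.sum_univ_two]

theorem braidAB : MA * MB * MA = MB * MA * MB := by
  ext i j
  fin_cases i <;> fin_cases j <;>
    simp [coeA, coeB, Matrix.SpecialLinearGroup.coe_mul, Matrix.mul_apply, Fin.sum_univ_two]

theorem psl_sq : ((QuotientGroup.mk MA * QuotientGroup.mk MB * QuotientGroup.mk MA) *
    (QuotientGroup.mk MA * QuotientGroup.mk MB * QuotientGroup.mk MA) : PSL2Z) = 1 :=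
  (QuotientGroup.eq_one_iff _).mpr center_neg

def genMap : Fin 3 → PSL2Z :=
  ![QuotientGroup.mk MA, QuotientGroup.mk MB, QuotientGroup.mk MA]

theorem genMap_rels : ∀ r ∈ m4Rels, FreeGroup.lift genMap r = 1 := by
  have hb : (QuotientGroup.mk MA * QuotientGroup.mk MB * QuotientGroup.mk MA : PSL2Z) =
    QuotientGroup.mk MB * QuotientGroup.mk MA * QuotientGroup.mk MB :=
    congrArg (QuotientGroup.mk : SL2Z → PSL2Z) braidAB
  have hs := psl_sq
  intro r hr
  rcases hr with rfl | rfl | rfl | rfl | hr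
  · simp [genMap]
  · simp only [map_mul, map_inv, FreeGroup.lift_apply_of]
    exact mul_inv_eq_one.mpr hb
  · simp only [map_mul, map_inv, FreeGroup.lift_apply_of]
    exact mul_inv_eq_one.mpr hb
  · simp only [map_mul, map_pow, FreeGroup.lift_apply_of]
    change (QuotientGroup.mk MA * QuotientGroup.mk MB * QuotientGroup.mk MA : PSL2Z) ^ 4 = 1
    rw [show 4 = 2 * 2 from rfl, pow_mul, pow_two (_ * _ * _), hs, one_pow]
  · rw [Set.mem_singleton_iff] at hr
    subst hr
    simp only [map_mul, map_pow, FreeGroup.lift_apply_of]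
    refine Eq.trans ?_ hs
    change (QuotientGroup.mk MA * QuotientGroup.mk MB * QuotientGroup.mk MA ^ 2 *
      QuotientGroup.mk MB * QuotientGroup.mk MA : PSL2Z) = _
    simp only [pow_two, mul_assoc]

theorem surj_aux (ι : M04 →* PSL2Z) (h1 : ι m4s1 = (QuotientGroup.mk MA : PSL2Z))
    (h2 : ι m4s2 = (QuotientGroup.mk MB : PSL2Z)) : Function.Surjective ι := by
  have hT : ModularGroup.T = MA := by
    ext i j
    fin_cases i <;> fin_cases j <;> simp [coeA, ModularGroup.T]
  have hS : ModularGroup.S = (MA * MB * MA)⁻¹ := by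
    ext i j
    fin_cases i <;> fin_cases j <;>
      simp [coeA, coeB, ModularGroup.S, Matrix.mul_apply, Fin.sum_univ_two,
        Matrix.adjugate_fin_two]
  have : ι.range.comap (QuotientGroup.mk' (Subgroup.center SL2Z)) = ⊤ := by
    rw [eq_top_iff, ← SpecialLinearGroup.SL2Z_generators, Subgroup.closure_le]
    rintro z (rfl | hz)
    · refine ⟨(m4s1 * m4s2 * m4s1)⁻¹, ?_⟩
      rw [hS]; simp only [map_mul, map_inv, h1, h2]; rfl
    · rw [Set.mem_singleton_iff] at hz
      subst hz
      refine ⟨m4s1, ?_⟩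
      rw [hT, h1]; rfl
  intro z
  obtain ⟨M, rfl⟩ := QuotientGroup.mk_surjective z
  have hM : M ∈ ι.range.comap (QuotientGroup.mk' (Subgroup.center SL2Z)) := by
    rw [this]; trivial
  exact hM

theorem ker_aux (ι : M04 →* PSL2Z) (h1 : ι m4s1 = (QuotientGroup.mk MA : PSL2Z))
    (h2 : ι m4s2 = (QuotientGroup.mk MB : PSL2Z))
    (h3 : ι m4s3 = (QuotientGroup.mk MA : PSL2Z)) : ι.ker = Nsub := by
  have hle : Nsub ≤ ι.ker := by
    rw [Nsub, Subgroup.closure_le]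
    rintro z (rfl | hz)
    · change ι _ = 1
      simp only [ea, map_mul, map_inv, h1, h3, mul_inv_cancel]
    · rw [Set.mem_singleton_iff] at hz
      subst hz
      change ι _ = 1
      simp only [eb, map_mul, map_inv, h1, h2, h3]; group
  apply le_antisymm _ hle
  haveI := N_normal
  let π := QuotientGroup.mk' Nsub
  let f : M04 ⧸ Nsub →* PSL2Z := QuotientGroup.lift Nsub ι hle
  have h13 : π m4s3 = π m4s1 := by
    rw [s3_eq, map_mul, map_inv]
    have : π ea = 1 := (QuotientGroup.eq_one_iff _).mpr ea_mem
    rw [this]; simp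
  have hb : π m4s1 * π m4s2 * π m4s1 = π m4s2 * π m4s1 * π m4s2 := by
    simp only [← map_mul, r12]
  have hs : (π m4s1 * π m4s2 * π m4s1) * (π m4s1 * π m4s2 * π m4s1) = 1 := by
    have := congrArg π r5
    simp only [map_mul, map_pow, h13, map_one] at this
    rw [← this]
    simp only [pow_two, mul_assoc]
  have hgen : Subgroup.closure {π m4s1, π m4s2} = ⊤ := by
    have := congrArg (Subgroup.map π) gen3
    rw [MonoidHom.map_closure, Subgroup.map_top_of_surjective π (QuotientGroup.mk'_surjective _)]
      at this
    rw [← this]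
    congr 1
    simp only [Set.image_insert_eq, Set.image_singleton, h13]
    ext z; simp only [Set.mem_insert_iff, Set.mem_singleton_iff]; tauto
  intro g hg
  exact (QuotientGroup.eq_one_iff g).mp (psl_inj hb hs hgen f h1 h2 (π g) hg)


theorem stmt9 :
    (∃! ι : M04 →* PSL2Z,
      ι m4s1 = (QuotientGroup.mk MA : PSL2Z) ∧
      ι m4s2 = (QuotientGroup.mk MB : PSL2Z) ∧
      ι m4s3 = (QuotientGroup.mk MA : PSL2Z)) ∧
    ∀ ι : M04 →* PSL2Z,
      ι m4s1 = (QuotientGroup.mk MA : PSL2Z) →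
      ι m4s2 = (QuotientGroup.mk MB : PSL2Z) →
      ι m4s3 = (QuotientGroup.mk MA : PSL2Z) →
      Function.Surjective ι ∧ ι.ker = Nsub := by

  refine ⟨⟨PresentedGroup.toGroup genMap_rels, ⟨?_, ?_, ?_⟩, ?_⟩, ?_⟩
  · exact PresentedGroup.toGroup.of genMap_rels
  · exact PresentedGroup.toGroup.of genMap_rels
  · exact PresentedGroup.toGroup.of genMap_rels
  · rintro κ ⟨h1, h2, h3⟩
    apply PresentedGroup.ext
    intro i
    rw [PresentedGroup.toGroup.of genMap_rels]
    fin_cases i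
    exacts [h1, h2, h3]
  · intro ι h1 h2 h3
    exact ⟨surj_aux ι h1 h2, ker_aux ι h1 h2 h3⟩
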